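/- Fix α > 0. There exists a constant C = C(α) > 0 such that for every T > 0 the following holds. Let ṽ, w̃ : [0,T] → L¹(ℝ²) be essentially bounded, and let h : [0,T] → L¹(ℝ²) satisfy h(s) - α²Δh(s) = ṽ(s) in the sense of distributions for a.e. s ∈ [0,T]; set u(s) = K * h(s). Then the bilinear expression 𝓑(ṽ,w̃)(t) := ∫₀ᵗ Σ_{j=1,2} ∂_jΦ(·,t-s) * (u_j(s) w̃(s)) ds satisfies sup_{t∈[0,T]} ‖𝓑(ṽ,w̃)(t)‖_{L¹(ℝ²)} ≤ C T^{1/2} ( sup_{s∈[0,T]} ‖ṽ(s)‖_{L¹} ) ( sup_{s∈[0,T]} ‖w̃(s)‖_{L¹} ). -/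

import Mathlib

open MeasureTheory Real ENNReal

noncomputable section

abbrev E2 := EuclideanSpace ℝ (Fin 2)

def e (i : Fin 2) : E2 := EuclideanSpace.single i 1

/-- Partial derivative in the `i`-th coordinate direction. -/
def pd (i : Fin 2) (f : E2 → ℝ) (x : E2) : ℝ := fderiv ℝ f x (e i)

/-- The Laplacian on `ℝ²`. -/
def lap (f : E2 → ℝ) (x : E2) : ℝ := ∑ i : Fin 2, pd i (pd i f) x

/-- `x^⊥ = (-x₂, x₁)`. -/
def perp (x : E2) : E2 := (WithLp.equiv 2 (Fin 2 → ℝ)).symm ![-x 1, x 0]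

/-- The Biot–Savart velocity field of a scalar function `w` on `ℝ²`. -/
def biotSavart (w : E2 → ℝ) (x : E2) : E2 :=
  ∫ y, ((2 * π * ‖x - y‖ ^ 2)⁻¹ * w y) • perp (x - y)

/-- The 2-D heat kernel `Φ(x,t) = (4πt)⁻¹ e^{-|x|²/(4t)}`. -/
def heatK (x : E2) (t : ℝ) : ℝ := (4 * π * t)⁻¹ * Real.exp (-‖x‖ ^ 2 / (4 * t))

/-- `∂_j Φ(x,t)`. -/
def dheatK (j : Fin 2) (x : E2) (t : ℝ) : ℝ := fderiv ℝ (fun y => heatK y t) x (e j)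

lemma heatK_nonneg (x : E2) {t : ℝ} (ht : 0 < t) : 0 ≤ heatK x t := by
  unfold heatK; positivity

lemma heatK_eq_gaussian (x : E2) (t : ℝ) :
    heatK x t = (4 * π * t)⁻¹ * Real.exp (-(4 * t)⁻¹ * ‖x‖ ^ 2) := by
  rw [heatK]; congr 2; ring

lemma dheatK_eq (j : Fin 2) (x : E2) (t : ℝ) :
    dheatK j x t = heatK x t * (-(2 * x j) / (4 * t)) := by
  have h1 : HasFDerivAt (fun y : E2 => ‖y‖ ^ 2) (2 • innerSL ℝ x) x :=
    (hasStrictFDerivAt_norm_sq x).hasFDerivAt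
  have h2 := ((h1.const_mul (-(4 * t)⁻¹)).exp).const_mul (4 * π * t)⁻¹
  have h3 : (fun y : E2 => heatK y t) =
      fun y => (4 * π * t)⁻¹ * Real.exp (-(4 * t)⁻¹ * ‖y‖ ^ 2) := by
    funext y; exact heatK_eq_gaussian y t
  unfold dheatK
  rw [h3, HasFDerivAt.fderiv h2]
  simp [heatK, e, div_eq_mul_inv, EuclideanSpace.inner_single_right]
  ring_nf

lemma continuous_dheatK (j : Fin 2) (t : ℝ) : Continuous fun x => dheatK j x t := by
  simp only [dheatK_eq, heatK]
  fun_prop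

lemma abs_dheatK_le (j : Fin 2) (x : E2) {t : ℝ} (ht : 0 < t) :
    |dheatK j x t| ≤ 2 * t ^ (-(1 / 2) : ℝ) * heatK x (2 * t) := by
  have hx : |x j| ≤ ‖x‖ := by simpa using PiLp.norm_apply_le x j
  set r := t ^ (-(1 / 2) : ℝ) with hr
  have hr0 : 0 < r := by positivity
  have hrr : r * r = t⁻¹ := by
    rw [hr, ← Real.rpow_add ht, ← Real.rpow_neg_one]; norm_num
  set a := ‖x‖ ^ 2 / (8 * t) with ha
  have hexp : a + 1 ≤ Real.exp a := Real.add_one_le_exp a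
  have h1 : heatK x t = (4 * π * t)⁻¹ * (Real.exp (-a) * Real.exp (-a)) := by
    rw [heatK, ← Real.exp_add]; congr 2; rw [ha]; field_simp; ring
  have h2 : heatK x (2 * t) = (4 * π * t)⁻¹ * Real.exp (-a) / 2 := by
    rw [heatK]; rw [show -‖x‖ ^ 2 / (4 * (2 * t)) = -a by rw [ha]; ring]; field_simp
  have h3 : ‖x‖ / (2 * t) ≤ r * Real.exp a := by
    have : ‖x‖ / (2 * t) ≤ r * (a + 1) := by
      have e1 : ‖x‖ / (2 * t) = r * ((‖x‖ * r) / 2) := by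
        rw [show r * ((‖x‖ * r) / 2) = ‖x‖ * (r * r) / 2 by ring, hrr]; field_simp
      have e2 : a = (‖x‖ * r) ^ 2 / 8 := by
        rw [show (‖x‖ * r) ^ 2 = ‖x‖ ^ 2 * (r * r) by ring, hrr, ha]; field_simp
      rw [e1, e2]
      gcongr
      nlinarith [sq_nonneg (‖x‖ * r - 2)]
    exact this.trans (by gcongr)
  have h4 : |dheatK j x t| ≤ heatK x t * (‖x‖ / (2 * t)) := by
    rw [dheatK_eq, abs_mul, abs_of_nonneg (heatK_nonneg x ht)]
    gcongr
    · exact heatK_nonneg x ht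
    · rw [abs_div, abs_neg, abs_mul, abs_of_pos (show 0 < 4 * t by positivity)]
      rw [show |(2:ℝ)| = 2 by norm_num]
      rw [div_le_div_iff₀ (by positivity) (by positivity)]
      nlinarith
  have hee : Real.exp (-a) * Real.exp a = 1 := by rw [← Real.exp_add]; simp
  calc |dheatK j x t| ≤ heatK x t * (‖x‖ / (2 * t)) := h4
    _ ≤ heatK x t * (r * Real.exp a) := by
        gcongr; exact heatK_nonneg x ht
    _ = 2 * r * heatK x (2 * t) := by
        rw [h1, h2]
        linear_combination (4 * π * t)⁻¹ * r * Real.exp (-a) * hee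

lemma integral_heatK {t : ℝ} (ht : 0 < t) : ∫ x, heatK x t = 1 := by
  simp only [heatK_eq_gaussian, integral_const_mul]
  rw [GaussianFourier.integral_rexp_neg_mul_sq_norm (by positivity)]
  simp
  field_simp

lemma integrable_heatK {t : ℝ} (ht : 0 < t) : Integrable fun x => heatK x t :=
  Integrable.of_integral_ne_zero (by rw [integral_heatK ht]; exact one_ne_zero)

lemma lintegral_heatK {t : ℝ} (ht : 0 < t) : ∫⁻ x, ENNReal.ofReal (heatK x t) = 1 := by
  rw [← ofReal_integral_eq_lintegral_ofReal (integrable_heatK ht)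
    (.of_forall fun x => heatK_nonneg x ht), integral_heatK ht, ENNReal.ofReal_one]

lemma heatK_le (x : E2) {t : ℝ} (ht : 0 < t) : heatK x t ≤ (4 * π * t)⁻¹ := by
  rw [heatK_eq_gaussian]
  refine mul_le_of_le_one_right (by positivity) (Real.exp_le_one_iff.2 ?_)
  have : 0 ≤ (4 * t)⁻¹ * ‖x‖ ^ 2 := by positivity
  linarith

lemma lintegral_enorm_dheatK_le (j : Fin 2) {t : ℝ} (ht : 0 < t) :
    ∫⁻ x, ‖dheatK j x t‖ₑ ≤ ENNReal.ofReal (2 * t ^ (-(1 / 2) : ℝ)) := by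
  calc ∫⁻ x, ‖dheatK j x t‖ₑ
      ≤ ∫⁻ x, ENNReal.ofReal (2 * t ^ (-(1 / 2) : ℝ)) * ENNReal.ofReal (heatK x (2 * t)) := by
        refine lintegral_mono fun x => ?_
        rw [Real.enorm_eq_ofReal_abs, ← ENNReal.ofReal_mul (by positivity)]
        exact ENNReal.ofReal_le_ofReal (abs_dheatK_le j x ht)
    _ = _ := by
        rw [lintegral_const_mul' _ _ ENNReal.ofReal_ne_top, lintegral_heatK (by positivity),
          mul_one]

lemma pd_mul {f g : E2 → ℝ} (hf : Differentiable ℝ f) (hg : Differentiable ℝ g) (i : Fin 2) :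
    pd i (fun x => f x * g x) = fun x => f x * pd i g x + pd i f x * g x := by
  funext x
  rw [pd, fderiv_fun_mul (hf x) (hg x)]
  simp [pd]
  ring

lemma pd_add {f g : E2 → ℝ} (hf : Differentiable ℝ f) (hg : Differentiable ℝ g) (i : Fin 2) :
    pd i (fun x => f x + g x) = fun x => pd i f x + pd i g x := by
  funext x
  rw [pd, fderiv_fun_add (hf x) (hg x)]
  simp [pd]

lemma contDiff_pd {f : E2 → ℝ} (hf : ContDiff ℝ (⊤ : ℕ∞) f) (i : Fin 2) :
    ContDiff ℝ (⊤ : ℕ∞) (pd i f) :=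
  (hf.fderiv_right (m := (⊤ : ℕ∞)) (by simp)).clm_apply contDiff_const

lemma hasCompactSupport_pd {f : E2 → ℝ} (hf : HasCompactSupport f) (i : Fin 2) :
    HasCompactSupport (pd i f) :=
  hf.fderiv_apply (𝕜 := ℝ) (e i)

lemma pd_comp_smul {f : E2 → ℝ} (c : ℝ) (i : Fin 2) :
    pd i (fun x => f (c • x)) = fun x => c * pd i f (c • x) := by
  funext x
  rw [pd, fderiv_comp_smul]
  simp [pd]

lemma pd_const_mul {f : E2 → ℝ} (hf : Differentiable ℝ f) (c : ℝ) (i : Fin 2) :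
    pd i (fun x => c * f x) = fun x => c * pd i f x := by
  funext x
  rw [pd, fderiv_const_mul (hf x)]
  simp [pd]

lemma pd_pd_mul {f g : E2 → ℝ} (hf : ContDiff ℝ (⊤ : ℕ∞) f) (hg : ContDiff ℝ (⊤ : ℕ∞) g)
    (i : Fin 2) : pd i (pd i fun x => f x * g x) =
      fun x => f x * pd i (pd i g) x + 2 * (pd i f x * pd i g x) + pd i (pd i f) x * g x := by
  have d {k : E2 → ℝ} (hk : ContDiff ℝ (⊤ : ℕ∞) k) : Differentiable ℝ k :=
    hk.differentiable (by simp)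
  have hf' := contDiff_pd hf i
  have hg' := contDiff_pd hg i
  rw [pd_mul (d hf) (d hg), pd_add (d (hf.mul hg')) (d (hf'.mul hg)), pd_mul (d hf) (d hg'),
    pd_mul (d hf') (d hg)]
  funext x
  ring

/-- The weak form of `h - α² Δh = v` extends from compactly supported test functions to smooth
functions that are bounded together with their derivatives. -/
lemma weak_eq_of_bounded {α : ℝ} {h v : E2 → ℝ} (hh : Integrable h) (hv : Integrable v)
    (heq : ∀ φ : E2 → ℝ, ContDiff ℝ (⊤ : ℕ∞) φ → HasCompactSupport φ →
      ∫ x, h x * (φ x - α ^ 2 * lap φ x) = ∫ x, v x * φ x)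
    {f : E2 → ℝ} (hf : ContDiff ℝ (⊤ : ℕ∞) f) {M : ℝ} (hM : ∀ x, |f x| ≤ M)
    (hM1 : ∀ i x, |pd i f x| ≤ M) (hM2 : ∀ i x, |pd i (pd i f) x| ≤ M) :
    ∫ x, h x * (f x - α ^ 2 * lap f x) = ∫ x, v x * f x := by
  have hM0 : 0 ≤ M := (abs_nonneg _).trans (hM 0)
  let χ : ContDiffBump (0 : E2) := ⟨1, 2, one_pos, one_lt_two⟩
  have hχ : ContDiff ℝ (⊤ : ℕ∞) χ := χ.contDiff
  have hχc : HasCompactSupport χ := χ.hasCompactSupport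
  have bdd {k : E2 → ℝ} (hk : ContDiff ℝ (⊤ : ℕ∞) k) (hc : HasCompactSupport k) :
      ∃ B, 0 ≤ B ∧ ∀ x, |k x| ≤ B := by
    obtain ⟨B, hB⟩ := hk.continuous.bounded_above_of_compact_support hc
    exact ⟨B, (norm_nonneg _).trans (hB 0), hB⟩
  choose B1 hB1n hB1 using fun i => bdd (contDiff_pd hχ i) (hasCompactSupport_pd hχc i)
  choose B2 hB2n hB2 using fun i => bdd (contDiff_pd (contDiff_pd hχ i) i)
    (hasCompactSupport_pd (hasCompactSupport_pd hχc i) i)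
  let c : ℕ → ℝ := fun n => 1 / ((n : ℝ) + 1)
  have hc : Filter.Tendsto c Filter.atTop (nhds 0) := tendsto_one_div_add_atTop_nhds_zero_nat
  have hc0 n : 0 < c n := Nat.one_div_pos_of_nat
  have hc1 n : c n ≤ 1 := by
    simp only [c]; rw [div_le_one (by positivity)]; linarith [(Nat.cast_nonneg n : (0:ℝ) ≤ n)]
  have hcx (x : E2) : Filter.Tendsto (fun n => c n • x) Filter.atTop (nhds 0) := by
    simpa using hc.smul_const x
  let X : ℕ → E2 → ℝ := fun n x => χ (c n • x)
  have hX n : ContDiff ℝ (⊤ : ℕ∞) (X n) := hχ.comp (contDiff_const_smul _)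
  have hXc n : HasCompactSupport (X n) := hχc.comp_smul (hc0 n).ne'
  have hX1 n i : pd i (X n) = fun x => c n * pd i χ (c n • x) := pd_comp_smul _ _
  have hX2 n i : pd i (pd i (X n)) = fun x => c n * (c n * pd i (pd i χ) (c n • x)) := by
    rw [hX1, pd_const_mul, pd_comp_smul]
    exact ((contDiff_pd hχ i).comp (contDiff_const_smul _)).differentiable (by simp)
  let φ : ℕ → E2 → ℝ := fun n x => X n x * f x
  have hφ n : ContDiff ℝ (⊤ : ℕ∞) (φ n) := (hX n).mul hf
  have hφc n : HasCompactSupport (φ n) := (hXc n).mul_right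
  have hφ2 n i : pd i (pd i (φ n)) = fun x => X n x * pd i (pd i f) x +
      2 * (c n * pd i χ (c n • x) * pd i f x) +
      c n * (c n * pd i (pd i χ) (c n • x)) * f x := by
    rw [pd_pd_mul (hX n) hf, hX2, hX1]
  have hX_le n x : |X n x| ≤ 1 := by
    rw [abs_of_nonneg χ.nonneg]; exact χ.le_one
  have hXlim x : Filter.Tendsto (fun n => X n x) Filter.atTop (nhds 1) := by
    have := (hχ.continuous.tendsto 0).comp (hcx x)
    rwa [χ.one_of_mem_closedBall (by simp [χ.rIn_pos.le])] at this
  have hφlim x : Filter.Tendsto (fun n => φ n x) Filter.atTop (nhds (f x)) := by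
    simpa using (hXlim x).mul_const (f x)
  have hlaplim x : Filter.Tendsto (fun n => lap (φ n) x) Filter.atTop (nhds (lap f x)) := by
    refine tendsto_finsetSum _ fun i _ => ?_
    simp only [hφ2]
    have l1 := ((contDiff_pd hχ i).continuous.tendsto 0).comp (hcx x)
    have l2 := ((contDiff_pd (contDiff_pd hχ i) i).continuous.tendsto 0).comp (hcx x)
    have := (((hXlim x).mul_const (pd i (pd i f) x)).add
      (((hc.mul l1).mul_const (pd i f x)).const_mul 2)).add
      ((hc.mul (hc.mul l2)).mul_const (f x))
    simpa using this
  have hφ_le n x : |φ n x| ≤ M := by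
    rw [abs_mul]
    exact (mul_le_mul (hX_le n x) (hM x) (abs_nonneg _) zero_le_one).trans_eq (one_mul _)
  have hlap_le n x : |lap (φ n) x| ≤ ∑ i, (M + 2 * (B1 i * M) + B2 i * M) := by
    refine (Finset.abs_sum_le_sum_abs _ _).trans (Finset.sum_le_sum fun i _ => ?_)
    simp only [hφ2]
    have c1 : |c n| ≤ 1 := by rw [abs_of_pos (hc0 n)]; exact hc1 n
    have t1 : |X n x * pd i (pd i f) x| ≤ 1 * M := by
      rw [abs_mul]; exact mul_le_mul (hX_le n x) (hM2 i x) (abs_nonneg _) zero_le_one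
    have t2 : |c n * pd i χ (c n • x) * pd i f x| ≤ 1 * B1 i * M := by
      rw [abs_mul, abs_mul]
      gcongr
      · exact mul_nonneg zero_le_one (hB1n i)
      · exact hB1 i _
      · exact hM1 i x
    have t3 : |c n * (c n * pd i (pd i χ) (c n • x)) * f x| ≤ 1 * (1 * B2 i) * M := by
      rw [abs_mul, abs_mul, abs_mul]
      have := hB2n i
      gcongr
      · exact hB2 i _
      · exact hM x
    refine (abs_add_three _ _ _).trans ?_
    rw [abs_mul 2, abs_two]
    linarith
  have hcont n : Continuous (lap (φ n)) :=
    continuous_finsetSum _ fun i _ => (contDiff_pd (contDiff_pd (hφ n) i) i).continuous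
  set L := ∑ i, (M + 2 * (B1 i * M) + B2 i * M)
  have lim1 : Filter.Tendsto (fun n => ∫ x, h x * (φ n x - α ^ 2 * lap (φ n) x)) Filter.atTop
      (nhds (∫ x, h x * (f x - α ^ 2 * lap f x))) := by
    refine tendsto_integral_of_dominated_convergence (fun x => |h x| * (M + α ^ 2 * L))
      (fun n => ?_) (hh.abs.mul_const _) (fun n => .of_forall fun x => ?_)
      (.of_forall fun x => ?_)
    · exact hh.aestronglyMeasurable.mul
        ((hφ n).continuous.sub (continuous_const.mul (hcont n))).aestronglyMeasurable
    · rw [Real.norm_eq_abs, abs_mul]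
      gcongr
      refine (abs_sub _ _).trans ?_
      rw [abs_mul (α ^ 2), abs_of_nonneg (sq_nonneg α)]
      gcongr
      · exact hφ_le n x
      · exact hlap_le n x
    · exact ((hφlim x).sub ((hlaplim x).const_mul _)).const_mul _
  have lim2 : Filter.Tendsto (fun n => ∫ x, v x * φ n x) Filter.atTop
      (nhds (∫ x, v x * f x)) := by
    refine tendsto_integral_of_dominated_convergence (fun x => |v x| * M)
      (fun n => ?_) (hv.abs.mul_const _) (fun n => .of_forall fun x => ?_)
      (.of_forall fun x => (hφlim x).const_mul _)
    · exact hv.aestronglyMeasurable.mul (hφ n).continuous.aestronglyMeasurable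
    · rw [Real.norm_eq_abs, abs_mul]
      gcongr
      exact hφ_le n x
  exact tendsto_nhds_unique lim1 (by simpa only [heq _ (hφ _) (hφc _)] using lim2)

/-- The weak form of `h - α² Δh = v` tested against plane waves. -/
lemma weak_eq_cos {α : ℝ} {h v : E2 → ℝ} (hh : Integrable h) (hv : Integrable v)
    (heq : ∀ φ : E2 → ℝ, ContDiff ℝ (⊤ : ℕ∞) φ → HasCompactSupport φ →
      ∫ x, h x * (φ x - α ^ 2 * lap φ x) = ∫ x, v x * φ x) (ξ : E2) (θ : ℝ) :
    (1 + α ^ 2 * ‖ξ‖ ^ 2) * ∫ x, h x * Real.cos (inner ℝ x ξ + θ) =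
      ∫ x, v x * Real.cos (inner ℝ x ξ + θ) := by
  let f : ℝ → E2 → ℝ := fun θ x => Real.cos (inner ℝ x ξ + θ)
  have hf θ : ContDiff ℝ (⊤ : ℕ∞) (f θ) :=
    Real.contDiff_cos.comp ((contDiff_id.inner ℝ contDiff_const).add contDiff_const)
  have hpd θ i : pd i (f θ) = fun x => ξ i * f (θ + π / 2) x := by
    funext x
    have h1 : HasFDerivAt (fun y : E2 => inner ℝ y ξ + θ) (innerSL ℝ ξ) x := by
      have := ((innerSL ℝ ξ).hasFDerivAt (x := x)).add_const θ
      simpa [real_inner_comm] using this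
    rw [pd, HasFDerivAt.fderiv h1.cos]
    simp only [f, ← add_assoc, Real.cos_add_pi_div_two]
    simp [e, EuclideanSpace.inner_single_right]
    ring
  have hpd2 θ i : pd i (pd i (f θ)) = fun x => -(ξ i) ^ 2 * f θ x := by
    rw [hpd, pd_const_mul ((hf _).differentiable (by simp)), hpd]
    funext x
    simp only [f, add_assoc, add_halves]
    rw [← add_assoc, Real.cos_add_pi]
    ring
  have hξ i : |ξ i| ≤ ‖ξ‖ := by simpa using PiLp.norm_apply_le ξ i
  have hb θ x : |f θ x| ≤ 1 := Real.abs_cos_le_one _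
  have hlap x : lap (f θ) x = -‖ξ‖ ^ 2 * f θ x := by
    simp only [lap, hpd2, EuclideanSpace.real_norm_sq_eq, Fin.sum_univ_two]
    ring
  have key := weak_eq_of_bounded hh hv heq (hf θ) (M := 1 + ‖ξ‖ + ‖ξ‖ ^ 2)
    (fun x => (hb _ x).trans (by nlinarith [norm_nonneg ξ]))
    (fun i x => by
      rw [hpd, abs_mul]
      nlinarith [norm_nonneg ξ, hb (θ + π / 2) x, hξ i, abs_nonneg (ξ i),
        abs_nonneg (f (θ + π / 2) x)])
    (fun i x => by
      rw [hpd2, abs_mul, abs_neg, abs_pow]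
      have : |ξ i| ^ 2 ≤ ‖ξ‖ ^ 2 := by gcongr; exact hξ i
      nlinarith [norm_nonneg ξ, hb θ x, sq_nonneg |ξ i|, abs_nonneg (f θ x)])
  rw [← key, ← integral_const_mul]
  refine integral_congr_ae (.of_forall fun x => ?_)
  simp only [hlap]
  simp only [f]
  ring

lemma weak_eq_exp {α : ℝ} {h v : E2 → ℝ} (hh : Integrable h) (hv : Integrable v)
    (heq : ∀ φ : E2 → ℝ, ContDiff ℝ (⊤ : ℕ∞) φ → HasCompactSupport φ →
      ∫ x, h x * (φ x - α ^ 2 * lap φ x) = ∫ x, v x * φ x) (ξ : E2) :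
    (1 + α ^ 2 * ‖ξ‖ ^ 2 : ℂ) * ∫ x, (h x : ℂ) * Complex.exp (inner ℝ x ξ * Complex.I) =
      ∫ x, (v x : ℂ) * Complex.exp (inner ℝ x ξ * Complex.I) := by
  have split {g : E2 → ℝ} (hg : Integrable g) :
      ∫ x, (g x : ℂ) * Complex.exp (inner ℝ x ξ * Complex.I) =
        ((∫ x, g x * Real.cos (inner ℝ x ξ + 0) : ℝ) : ℂ) +
        ((∫ x, g x * Real.cos (inner ℝ x ξ + -(π / 2)) : ℝ) : ℂ) * Complex.I := by
    have hi θ : Integrable fun x => g x * Real.cos (inner ℝ x ξ + θ) := by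
      refine hg.mul_bdd (c := 1) (Continuous.aestronglyMeasurable (by fun_prop))
        (.of_forall fun x => by simpa using Real.abs_cos_le_one _)
    rw [← integral_complex_ofReal, ← integral_complex_ofReal, ← integral_mul_const,
      ← integral_add (hi 0).ofReal ((hi _).ofReal.mul_const _)]
    refine integral_congr_ae (.of_forall fun x => ?_)
    simp only [← sub_eq_add_neg, Real.cos_sub_pi_div_two, Complex.exp_mul_I, add_zero]
    push_cast
    ring
  rw [split hh, split hv, ← weak_eq_cos hh hv heq, ← weak_eq_cos hh hv heq]
  push_cast
  ring

/-- The singular weight `|x|⁻¹` on `ℝ²`, with values in `ℝ≥0∞` (and value `0` at the origin). -/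
def invNorm (x : E2) : ℝ≥0∞ := ENNReal.ofReal ‖x‖⁻¹

lemma measurable_invNorm : Measurable invNorm := by
  unfold invNorm; fun_prop

lemma invNorm_smul {c : ℝ} (hc : 0 ≤ c) (x : E2) :
    invNorm (c • x) = ENNReal.ofReal c⁻¹ * invNorm x := by
  rw [invNorm, invNorm, ← ENNReal.ofReal_mul (by positivity), norm_smul, mul_inv,
    Real.norm_of_nonneg hc]

lemma setLIntegral_ball_invNorm_lt_top :
    ∫⁻ x in Metric.ball (0 : E2) 1, invNorm x < ⊤ := by
  have h : IntegrableOn (fun x : E2 => ‖x‖⁻¹) (Metric.ball 0 1) := by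
    refine integrableOn_ball_of_norm_le_rpow (α := 1) (C := 1) (by simp) (by simp)
      (.of_forall fun x => ?_) (Measurable.aestronglyMeasurable (by fun_prop))
    rw [Real.rpow_neg_one]; simp
  have := h.lintegral_lt_top
  simpa only [invNorm] using this

/-- The Gaussian probability measure with density `Φ(·, α²)`. -/
def gaussMeas (α : ℝ) : Measure E2 :=
  volume.withDensity fun x => ENNReal.ofReal (heatK x (α ^ 2))

/-- The exponential distribution on `(0, ∞)`. -/
def expoMeas : Measure ℝ :=
  (volume.restrict (Set.Ioi 0)).withDensity fun τ => ENNReal.ofReal (Real.exp (-τ))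

/-- The law with density the Bessel kernel of `(1 - α²Δ)⁻¹`, as an exponential mixture of
Gaussians. -/
def besselMeas (α : ℝ) : Measure E2 :=
  (expoMeas.prod (gaussMeas α)).map fun p => √p.1 • p.2

lemma continuous_heatK (t : ℝ) : Continuous fun x => heatK x t := by
  unfold heatK; fun_prop

lemma isProbabilityMeasure_gaussMeas {α : ℝ} (hα : 0 < α) :
    IsProbabilityMeasure (gaussMeas α) :=
  ⟨by simp [gaussMeas, lintegral_heatK (pow_pos hα 2)]⟩

instance : IsProbabilityMeasure expoMeas := by
  refine ⟨?_⟩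
  rw [expoMeas, withDensity_apply _ .univ, Measure.restrict_univ,
    ← ofReal_integral_eq_lintegral_ofReal ?_ (.of_forall fun _ => (Real.exp_pos _).le)]
  · rw [integral_exp_neg_Ioi]; simp
  · exact integrableOn_exp_neg_Ioi 0

lemma measurable_scale : Measurable fun p : ℝ × E2 => √p.1 • p.2 := by fun_prop

lemma isProbabilityMeasure_besselMeas {α : ℝ} (hα : 0 < α) :
    IsProbabilityMeasure (besselMeas α) := by
  have := isProbabilityMeasure_gaussMeas hα
  exact Measure.isProbabilityMeasure_map measurable_scale.aemeasurable

lemma charFun_gaussMeas {α : ℝ} (hα : 0 < α) (ξ : E2) :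
    charFun (gaussMeas α) ξ = Complex.exp (-(α ^ 2 * ‖ξ‖ ^ 2 : ℝ)) := by
  rw [charFun_apply, gaussMeas, integral_withDensity_eq_integral_toReal_smul
    (continuous_heatK _).measurable.ennreal_ofReal (.of_forall fun _ => ENNReal.ofReal_lt_top)]
  have hb : 0 < ((4 * α ^ 2 : ℝ)⁻¹ : ℂ).re := by
    rw [← Complex.ofReal_inv, Complex.ofReal_re]; positivity
  have key := GaussianFourier.integral_cexp_neg_mul_sq_norm_add hb Complex.I ξ
  have hα' : (α : ℂ) ≠ 0 := by exact_mod_cast hα.ne'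
  have hπ : (π : ℂ) ≠ 0 := by exact_mod_cast Real.pi_ne_zero
  have : ∀ x : E2, (ENNReal.ofReal (heatK x (α ^ 2))).toReal •
      Complex.exp (inner ℝ x ξ * Complex.I) = (4 * π * α ^ 2 : ℂ)⁻¹ *
        Complex.exp (-((4 * α ^ 2 : ℝ)⁻¹ : ℂ) * ‖x‖ ^ 2 + Complex.I * inner ℝ ξ x) := by
    intro x
    rw [ENNReal.toReal_ofReal (heatK_nonneg x (by positivity)), Complex.real_smul,
      heatK_eq_gaussian, Complex.exp_add, real_inner_comm]
    push_cast
    rw [mul_comm Complex.I, mul_assoc]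
  simp only [this, integral_const_mul, key]
  simp only [finrank_euclideanSpace, Fintype.card_fin, Complex.I_sq]
  push_cast
  rw [div_self two_ne_zero, Complex.cpow_one, ← mul_assoc]
  have e1 : (4 * π * α ^ 2 : ℂ)⁻¹ * (π / (4 * α ^ 2 : ℂ)⁻¹) = 1 := by field_simp
  rw [e1, one_mul]
  congr 1
  field_simp

lemma charFun_besselMeas {α : ℝ} (hα : 0 < α) (ξ : E2) :
    (1 + α ^ 2 * ‖ξ‖ ^ 2 : ℂ) * charFun (besselMeas α) ξ = 1 := by
  have := isProbabilityMeasure_gaussMeas hα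
  have hpos : 0 < 1 + α ^ 2 * ‖ξ‖ ^ 2 := by positivity
  have hm : Continuous fun x : E2 => Complex.exp (inner ℝ x ξ * Complex.I) := by fun_prop
  have hint : Integrable (fun p : ℝ × E2 => Complex.exp (inner ℝ (√p.1 • p.2) ξ * Complex.I))
      (expoMeas.prod (gaussMeas α)) := by
    refine Integrable.of_bound
      (hm.measurable.comp measurable_scale).aestronglyMeasurable 1 (.of_forall fun p => ?_)
    rw [Complex.norm_exp_ofReal_mul_I]
  have h1 : charFun (besselMeas α) ξ = ∫ τ, charFun (gaussMeas α) (√τ • ξ) ∂expoMeas := by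
    rw [charFun_apply, besselMeas,
      integral_map measurable_scale.aemeasurable hm.aestronglyMeasurable, integral_prod _ hint]
    refine integral_congr_ae (.of_forall fun τ => ?_)
    simp only [charFun_apply, inner_smul_left, inner_smul_right]
    simp
  have h2 : charFun (besselMeas α) ξ =
      ∫ τ in Set.Ioi (0 : ℝ), Complex.exp (-(1 + α ^ 2 * ‖ξ‖ ^ 2 : ℝ) * τ) := by
    rw [h1, expoMeas, integral_withDensity_eq_integral_toReal_smul (by fun_prop)
      (.of_forall fun _ => ENNReal.ofReal_lt_top)]
    refine setIntegral_congr_fun measurableSet_Ioi fun τ hτ => ?_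
    have hτ' : 0 ≤ τ := le_of_lt hτ
    simp only [charFun_gaussMeas hα]
    rw [ENNReal.toReal_ofReal (Real.exp_pos _).le, Complex.real_smul, norm_smul, mul_pow,
      Real.norm_of_nonneg (Real.sqrt_nonneg _), Real.sq_sqrt hτ', Complex.ofReal_exp,
      ← Complex.exp_add]
    congr 1
    push_cast
    ring
  rw [h2, integral_exp_mul_complex_Ioi (by rw [← Complex.ofReal_neg, Complex.ofReal_re]; linarith)]
  have hne : (1 + α ^ 2 * ‖ξ‖ ^ 2 : ℂ) ≠ 0 := by exact_mod_cast hpos.ne'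
  push_cast
  simp only [mul_zero, Complex.exp_zero]
  field_simp

lemma lintegral_invNorm_gaussMeas_le {α : ℝ} (hα : 0 < α) (z : E2) :
    ∫⁻ a, invNorm (z - a) ∂(gaussMeas α) ≤ ENNReal.ofReal (4 * π * α ^ 2)⁻¹ *
      (∫⁻ x in Metric.ball (0 : E2) 1, invNorm x) + 1 := by
  have hm : Measurable fun a : E2 => invNorm (z - a) := measurable_invNorm.comp (by fun_prop)
  let B : E2 → ℝ≥0∞ := (Metric.ball (0 : E2) 1).indicator invNorm
  have hB : Measurable B := measurable_invNorm.indicator measurableSet_ball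
  have hle x : invNorm x ≤ B x + 1 := by
    by_cases hx : ‖x‖ < 1
    · simp [B, hx]
    · refine le_add_left ?_
      rw [invNorm, ENNReal.ofReal_le_one]
      exact inv_le_one_of_one_le₀ (not_lt.1 hx)
  rw [gaussMeas, lintegral_withDensity_eq_lintegral_mul _
    (continuous_heatK _).measurable.ennreal_ofReal hm]
  calc ∫⁻ a, ENNReal.ofReal (heatK a (α ^ 2)) * invNorm (z - a)
      ≤ ∫⁻ a, (ENNReal.ofReal (4 * π * α ^ 2)⁻¹ * B (z - a) +
          ENNReal.ofReal (heatK a (α ^ 2))) := by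
        refine lintegral_mono fun a => ?_
        refine (mul_le_mul_right (hle (z - a)) _).trans ?_
        rw [mul_add, mul_one]
        gcongr
        exact heatK_le a (by positivity)
    _ = _ := by
        rw [lintegral_add_right _ (continuous_heatK _).measurable.ennreal_ofReal,
          lintegral_heatK (by positivity), lintegral_const_mul' _ _ ENNReal.ofReal_ne_top,
          lintegral_sub_left_eq_self B z, lintegral_indicator measurableSet_ball]

lemma lintegral_expoMeas_inv_sqrt_lt_top :
    ∫⁻ τ, ENNReal.ofReal (√τ)⁻¹ ∂expoMeas < ⊤ := by
  rw [expoMeas, lintegral_withDensity_eq_lintegral_mul _ (by fun_prop) (by fun_prop)]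
  have := (Real.GammaIntegral_convergent (s := 1 / 2) (by norm_num)).lintegral_lt_top
  refine lt_of_le_of_lt (setLIntegral_mono' measurableSet_Ioi fun τ hτ => ?_) this
  rw [Pi.mul_apply, ← ENNReal.ofReal_mul (Real.exp_pos _).le, Real.sqrt_eq_rpow,
    ← Real.rpow_neg (le_of_lt hτ)]
  norm_num

lemma exists_lintegral_invNorm_besselMeas_le {α : ℝ} (hα : 0 < α) :
    ∃ M : ℝ≥0∞, M ≠ ⊤ ∧ ∀ z, ∫⁻ a, invNorm (z - a) ∂(besselMeas α) ≤ M := by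
  have := isProbabilityMeasure_gaussMeas hα
  set M₀ := ENNReal.ofReal (4 * π * α ^ 2)⁻¹ *
      (∫⁻ x in Metric.ball (0 : E2) 1, invNorm x) + 1
  refine ⟨(∫⁻ τ, ENNReal.ofReal (√τ)⁻¹ ∂expoMeas) * M₀, ?_, fun z => ?_⟩
  · refine ENNReal.mul_ne_top lintegral_expoMeas_inv_sqrt_lt_top.ne
      (ENNReal.add_ne_top.2 ⟨ENNReal.mul_ne_top ENNReal.ofReal_ne_top
        setLIntegral_ball_invNorm_lt_top.ne, ENNReal.one_ne_top⟩)
  have hm : Measurable fun a : E2 => invNorm (z - a) := measurable_invNorm.comp (by fun_prop)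
  rw [besselMeas, lintegral_map hm measurable_scale,
    lintegral_prod (fun p : ℝ × E2 => invNorm (z - √p.1 • p.2))
      (hm.comp measurable_scale).aemeasurable,
    ← lintegral_mul_const _ (by fun_prop)]
  have hae : ∀ᵐ τ ∂expoMeas, 0 < τ :=
    (withDensity_absolutelyContinuous _ _).ae_le (ae_restrict_mem measurableSet_Ioi)
  refine lintegral_mono_ae (hae.mono fun τ hτ => ?_)
  have hs : 0 < √τ := Real.sqrt_pos.2 hτ
  have e1 a : invNorm (z - √τ • a) = ENNReal.ofReal (√τ)⁻¹ * invNorm ((√τ)⁻¹ • z - a) := by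
    rw [← invNorm_smul hs.le, smul_sub, smul_inv_smul₀ hs.ne']
  simp only [e1]
  rw [lintegral_const_mul' _ _ ENNReal.ofReal_ne_top]
  gcongr
  exact lintegral_invNorm_gaussMeas_le hα _

/-- The positive part of `f dx`. -/
def posMeas (f : E2 → ℝ) : Measure E2 := volume.withDensity fun x => ENNReal.ofReal (f x)

lemma isFiniteMeasure_posMeas {f : E2 → ℝ} (hf : Integrable f) : IsFiniteMeasure (posMeas f) :=
  isFiniteMeasure_withDensity_ofReal hf.2

instance (f : E2 → ℝ) : SFinite (posMeas f) := by
  unfold posMeas; infer_instance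

lemma integrable_cexp_inner (μ : Measure E2) [IsFiniteMeasure μ] (ξ : E2) :
    Integrable (fun x : E2 => Complex.exp (inner ℝ x ξ * Complex.I)) μ := by
  refine Integrable.of_bound (Continuous.aestronglyMeasurable (by fun_prop)) 1
    (.of_forall fun x => ?_)
  rw [Complex.norm_exp_ofReal_mul_I]

lemma charFun_add {μ ν : Measure E2} [IsFiniteMeasure μ] [IsFiniteMeasure ν] (ξ : E2) :
    charFun (μ + ν) ξ = charFun μ ξ + charFun ν ξ := by
  simp only [charFun_apply]
  exact integral_add_measure (integrable_cexp_inner μ ξ) (integrable_cexp_inner ν ξ)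

lemma charFun_posMeas_sub {f : E2 → ℝ} (hfm : Measurable f) (hf : Integrable f) (ξ : E2) :
    charFun (posMeas f) ξ - charFun (posMeas fun x => -f x) ξ =
      ∫ x, (f x : ℂ) * Complex.exp (inner ℝ x ξ * Complex.I) := by
  have hb : ∀ᵐ x : E2, ‖Complex.exp (inner ℝ x ξ * Complex.I)‖ ≤ 1 :=
    .of_forall fun x => by rw [Complex.norm_exp_ofReal_mul_I]
  have hm : AEStronglyMeasurable (fun x : E2 => Complex.exp (inner ℝ x ξ * Complex.I)) :=
    Continuous.aestronglyMeasurable (by fun_prop)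
  have hi {g : E2 → ℝ} (hg : Integrable g) : Integrable fun x =>
      (ENNReal.ofReal (g x)).toReal • Complex.exp (inner ℝ x ξ * Complex.I) := by
    have hg' : Integrable fun x => ((ENNReal.ofReal (g x)).toReal : ℂ) := by
      simp only [ENNReal.toReal_ofReal']
      exact hg.pos_part.ofReal
    simpa only [Complex.real_smul] using hg'.mul_bdd hm hb
  rw [charFun_apply, charFun_apply, posMeas, posMeas,
    integral_withDensity_eq_integral_toReal_smul (by fun_prop)
      (.of_forall fun _ => ENNReal.ofReal_lt_top),
    integral_withDensity_eq_integral_toReal_smul (by fun_prop)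
      (.of_forall fun _ => ENNReal.ofReal_lt_top), ← integral_sub (hi hf)
      (hi (g := fun x => -f x) hf.neg)]
  refine integral_congr_ae (.of_forall fun x => ?_)
  simp only [Complex.real_smul, ENNReal.toReal_ofReal']
  rw [← sub_mul, ← Complex.ofReal_sub, max_zero_sub_max_neg_zero_eq_self]

lemma posMeas_add_conv_eq {α : ℝ} (hα : 0 < α) {h v : E2 → ℝ} (hhm : Measurable h)
    (hvm : Measurable v) (hh : Integrable h) (hv : Integrable v)
    (heq : ∀ φ : E2 → ℝ, ContDiff ℝ (⊤ : ℕ∞) φ → HasCompactSupport φ →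
      ∫ x, h x * (φ x - α ^ 2 * lap φ x) = ∫ x, v x * φ x) :
    posMeas h + (posMeas fun x => -v x).conv (besselMeas α) =
      (posMeas fun x => -h x) + (posMeas v).conv (besselMeas α) := by
  have := isFiniteMeasure_posMeas hh
  have := isFiniteMeasure_posMeas hv
  have : IsFiniteMeasure (posMeas fun x => -h x) := isFiniteMeasure_posMeas hh.neg
  have : IsFiniteMeasure (posMeas fun x => -v x) := isFiniteMeasure_posMeas hv.neg
  have := isProbabilityMeasure_besselMeas hα
  refine Measure.ext_of_charFun (funext fun ξ => ?_)
  rw [charFun_add, charFun_add, charFun_conv, charFun_conv]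
  have e1 := charFun_posMeas_sub hhm hh ξ
  have e2 := charFun_posMeas_sub hvm hv ξ
  have e3 := weak_eq_exp hh hv heq ξ
  have e4 := charFun_besselMeas hα ξ
  rw [← e1, ← e2] at e3
  linear_combination charFun (besselMeas α) ξ * e3 -
    (charFun (posMeas h) ξ - charFun (posMeas fun x => -h x) ξ) * e4

lemma posMeas_le_of_add_eq {h : E2 → ℝ} (hh : Measurable h) {μ ν : Measure E2}
    (H : posMeas h + μ = (posMeas fun x => -h x) + ν) : posMeas h ≤ ν := by
  refine Measure.le_iff.2 fun A hA => ?_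
  have hP : MeasurableSet {x | 0 < h x} := hh measurableSet_Ioi
  have z1 : posMeas h (A \ {x | 0 < h x}) = 0 := by
    rw [posMeas, withDensity_apply _ (hA.diff hP)]
    refine (setLIntegral_congr_fun (hA.diff hP) fun x hx => ?_).trans lintegral_zero
    exact ENNReal.ofReal_of_nonpos (not_lt.1 hx.2)
  have z2 : posMeas (fun x => -h x) (A ∩ {x | 0 < h x}) = 0 := by
    rw [posMeas, withDensity_apply _ (hA.inter hP)]
    refine (setLIntegral_congr_fun (hA.inter hP) fun x hx => ?_).trans lintegral_zero
    have : 0 < h x := hx.2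
    exact ENNReal.ofReal_of_nonpos (by linarith)
  have H' := congrArg (fun m : Measure E2 => m (A ∩ {x | 0 < h x})) H
  simp only [Measure.add_apply, z2, zero_add] at H'
  calc posMeas h A = posMeas h (A ∩ {x | 0 < h x}) := by
        rw [← measure_inter_add_sdiff A hP, z1, add_zero]
    _ ≤ posMeas h (A ∩ {x | 0 < h x}) + μ (A ∩ {x | 0 < h x}) := le_self_add
    _ = ν (A ∩ {x | 0 < h x}) := H'
    _ ≤ ν A := measure_mono Set.inter_subset_left

lemma lintegral_posMeas_add {f : E2 → ℝ} (hf : Measurable f) {g : E2 → ℝ≥0∞}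
    (hg : Measurable g) :
    ∫⁻ x, g x ∂(posMeas f) + ∫⁻ x, g x ∂(posMeas fun x => -f x) = ∫⁻ x, g x * ‖f x‖ₑ := by
  rw [posMeas, posMeas, lintegral_withDensity_eq_lintegral_mul _ (by fun_prop) hg,
    lintegral_withDensity_eq_lintegral_mul _ (by fun_prop) hg,
    ← lintegral_add_left (Measurable.mul (by fun_prop) hg)]
  refine lintegral_congr fun x => ?_
  simp only [Pi.mul_apply]
  rw [← add_mul, mul_comm, Real.enorm_eq_ofReal_abs]
  congr 1
  rcases le_total 0 (f x) with h | h
  · rw [abs_of_nonneg h, ENNReal.ofReal_of_nonpos (neg_nonpos.2 h), add_zero]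
  · rw [abs_of_nonpos h, ENNReal.ofReal_of_nonpos h, zero_add]

lemma lintegral_invNorm_mul_le {α : ℝ} (hα : 0 < α) {M : ℝ≥0∞}
    (hM : ∀ z, ∫⁻ a, invNorm (z - a) ∂(besselMeas α) ≤ M) {h v : E2 → ℝ} (hh : Integrable h)
    (hv : Integrable v)
    (heq : ∀ φ : E2 → ℝ, ContDiff ℝ (⊤ : ℕ∞) φ → HasCompactSupport φ →
      ∫ x, h x * (φ x - α ^ 2 * lap φ x) = ∫ x, v x * φ x) (x : E2) :
    ∫⁻ y, invNorm (x - y) * ‖h y‖ₑ ≤ M * eLpNorm v 1 volume := by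
  wlog hm : Measurable h ∧ Measurable v generalizing h v
  · obtain ⟨h', hh', eh⟩ := hh.aestronglyMeasurable.aemeasurable
    obtain ⟨v', hv', ev⟩ := hv.aestronglyMeasurable.aemeasurable
    have := this (hh.congr eh) (hv.congr ev) (fun φ hφ hφc => ?_) ⟨hh', hv'⟩
    · rw [eLpNorm_congr_ae ev]
      refine (lintegral_congr_ae ?_).trans_le this
      filter_upwards [eh] with y hy
      rw [hy]
    · exact ((integral_congr_ae (eh.symm.mul (.refl _ fun x => φ x - α ^ 2 * lap φ x))).trans
        (heq φ hφ hφc)).trans (integral_congr_ae (ev.mul (.refl _ φ)))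
  obtain ⟨hhm, hvm⟩ := hm
  have := isProbabilityMeasure_besselMeas hα
  have hN : Measurable fun y : E2 => invNorm (x - y) := measurable_invNorm.comp (by fun_prop)
  have key := posMeas_add_conv_eq hα hhm hvm hh hv heq
  have le1 : posMeas h ≤ (posMeas v).conv (besselMeas α) := posMeas_le_of_add_eq hhm key
  have le2 : (posMeas fun x => -h x) ≤ (posMeas fun x => -v x).conv (besselMeas α) := by
    refine posMeas_le_of_add_eq hhm.neg (μ := (posMeas v).conv (besselMeas α)) ?_
    simp only [Pi.neg_apply, neg_neg]
    exact key.symm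
  have bound (f : E2 → ℝ) : ∫⁻ y, invNorm (x - y) ∂((posMeas f).conv (besselMeas α)) ≤
      ∫⁻ _, M ∂(posMeas f) := by
    rw [Measure.lintegral_conv hN]
    refine lintegral_mono fun b => ?_
    simp only [← sub_sub]
    exact hM (x - b)
  rw [← lintegral_posMeas_add hhm hN]
  calc _ ≤ ∫⁻ _, M ∂(posMeas v) + ∫⁻ _, M ∂(posMeas fun x => -v x) :=
        add_le_add ((lintegral_mono' le1 le_rfl).trans (bound _))
          ((lintegral_mono' le2 le_rfl).trans (bound _))
    _ = M * eLpNorm v 1 volume := by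
        rw [lintegral_posMeas_add hvm measurable_const, lintegral_const_mul _ (by fun_prop),
          eLpNorm_one_eq_lintegral_enorm]

lemma norm_perp (x : E2) : ‖perp x‖ = ‖x‖ := by
  rw [EuclideanSpace.norm_eq, EuclideanSpace.norm_eq]
  congr 1
  simp [perp, Fin.sum_univ_two]
  ring

lemma enorm_biotSavart_kernel (x : E2) (c : ℝ) :
    ‖((2 * π * ‖x‖ ^ 2)⁻¹ * c) • perp x‖ₑ = ENNReal.ofReal (2 * π)⁻¹ * (invNorm x * ‖c‖ₑ) := by
  rw [← ofReal_norm, ← ofReal_norm, invNorm, ← ENNReal.ofReal_mul (by positivity),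
    ← ENNReal.ofReal_mul (by positivity), norm_smul, norm_perp, norm_mul,
    Real.norm_of_nonneg (by positivity)]
  congr 1
  rcases eq_or_ne ‖x‖ 0 with h | h
  · simp [h]
  · field_simp

lemma enorm_biotSavart_le (w : E2 → ℝ) (x : E2) (j : Fin 2) :
    ‖biotSavart w x j‖ₑ ≤ ∫⁻ y, invNorm (x - y) * ‖w y‖ₑ := by
  have h1 : ‖biotSavart w x j‖ₑ ≤ ‖biotSavart w x‖ₑ := by
    rw [← ofReal_norm, ← ofReal_norm]
    exact ENNReal.ofReal_le_ofReal (PiLp.norm_apply_le _ j)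
  have hc : ENNReal.ofReal (2 * π)⁻¹ ≤ 1 := by
    rw [ENNReal.ofReal_le_one]
    exact inv_le_one_of_one_le₀ (by linarith [Real.pi_gt_three])
  refine h1.trans ((enorm_integral_le_lintegral_enorm _).trans (lintegral_mono fun y => ?_))
  simp only [enorm_biotSavart_kernel]
  exact mul_le_of_le_one_left' hc

lemma continuous_perp : Continuous perp := by
  unfold perp
  refine (PiLp.continuous_toLp 2 _).comp (continuous_pi fun i => ?_)
  fin_cases i <;> simp <;> fun_prop

lemma stronglyMeasurable_biotSavart {w : E2 → ℝ} (hw : AEStronglyMeasurable w) :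
    StronglyMeasurable (biotSavart w) := by
  have hm := hw.stronglyMeasurable_mk
  have : biotSavart w = biotSavart (hw.mk w) := by
    funext x
    refine integral_congr_ae ?_
    filter_upwards [hw.ae_eq_mk] with y hy
    rw [hy]
  rw [this]
  refine StronglyMeasurable.integral_prod_right
    (f := fun x y => ((2 * π * ‖x - y‖ ^ 2)⁻¹ * hw.mk w y) • perp (x - y)) ?_
  refine StronglyMeasurable.smul (StronglyMeasurable.mul ?_ (hm.comp_measurable measurable_snd)) ?_
  · exact Measurable.stronglyMeasurable (by fun_prop)
  · exact (continuous_perp.comp (continuous_fst.sub continuous_snd)).stronglyMeasurable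

lemma measurable_uncurry_of_dense_aemeasurable {X : Type*} [TopologicalSpace X]
    [TopologicalSpace.MetrizableSpace X] [SecondCountableTopology X] [MeasurableSpace X]
    [OpensMeasurableSpace X] {S : Type*} [MeasurableSpace S] {μ : Measure S} {G : S → X → ℝ}
    (hG : ∀ᵐ s ∂μ, Continuous (G s)) (hm : ∀ x, AEStronglyMeasurable (fun s => G s x) μ) :
    ∃ G' : S → X → ℝ, Measurable (Function.uncurry G') ∧ ∀ᵐ s ∂μ, G' s = G s := by
  obtain ⟨D, hDc, hD⟩ := TopologicalSpace.exists_countable_dense X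
  have hae : ∀ᵐ s ∂μ, Continuous (G s) ∧ ∀ d ∈ D, G s d = (hm d).mk _ s := by
    refine hG.and ((ae_ball_iff hDc).2 fun d _ => (hm d).ae_eq_mk)
  set N := toMeasurable μ {s | ¬(Continuous (G s) ∧ ∀ d ∈ D, G s d = (hm d).mk _ s)} with hN
  have hN0 : μ N = 0 := by rw [hN, measure_toMeasurable]; exact hae
  have hNm : MeasurableSet N := measurableSet_toMeasurable _ _
  have hNc s (hs : s ∉ N) : Continuous (G s) ∧ ∀ d ∈ D, G s d = (hm d).mk _ s := by
    by_contra h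
    exact hs (subset_toMeasurable μ _ h)
  classical
  let G' : S → X → ℝ := fun s x => Nᶜ.indicator (fun s => G s x) s
  have hcont s : Continuous (G' s) := by
    by_cases hs : s ∈ N
    · simpa [G', hs] using continuous_const
    · simpa [G', hs] using (hNc s hs).1
  have hmeasD d (hd : d ∈ D) : Measurable fun s => G' s d := by
    have : (fun s => G' s d) = Nᶜ.indicator ((hm d).mk _) := by
      funext s
      by_cases hs : s ∈ N
      · simp [G', hs]
      · simp [G', hs, (hNc s hs).2 d hd]
    rw [this]
    exact (hm d).stronglyMeasurable_mk.measurable.indicator hNm.compl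
  have hmeas x : Measurable fun s => G' s x := by
    obtain ⟨d, hdD, hd⟩ := mem_closure_iff_seq_limit.1 (hD x)
    exact measurable_of_tendsto_metrizable (fun n => hmeasD (d n) (hdD n))
      (tendsto_pi_nhds.2 fun s => ((hcont s).tendsto x).comp hd)
  refine ⟨G', ?_, ?_⟩
  · have := measurable_uncurry_of_continuous_of_measurable (u := fun x s => G' s x) hcont hmeas
    exact this.comp measurable_swap
  · filter_upwards [compl_mem_ae_iff.2 hN0] with s hs
    funext x
    exact Set.indicator_of_mem hs _

/-- Minkowski's inequality in `L¹` for a family of continuous functions. No joint measurability is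
required, since the set where the integrand is measurable in the parameter is closed. -/
lemma lintegral_enorm_integral_le {S : Type*} [MeasurableSpace S] {μ : Measure S} [SFinite μ]
    {G : S → E2 → ℝ} (hG : ∀ᵐ s ∂μ, Continuous (G s)) {b : S → ℝ≥0∞}
    (hb : ∀ᵐ s ∂μ, ∫⁻ x, ‖G s x‖ₑ ≤ b s) :
    ∫⁻ x, ‖∫ s, G s x ∂μ‖ₑ ≤ ∫⁻ s, b s ∂μ := by
  set X := {x | AEStronglyMeasurable (fun s => G s x) μ} with hX
  have hXcl : IsClosed X := by
    refine IsSeqClosed.isClosed fun u x hu hux => ?_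
    exact aestronglyMeasurable_of_tendsto_ae Filter.atTop hu
      (hG.mono fun s hs => (hs.tendsto x).comp hux)
  have hXm := hXcl.measurableSet
  have := hXcl.isClosedEmbedding_subtypeVal.locallyCompactSpace
  have : IsFiniteMeasureOnCompacts ((volume : Measure E2).comap ((↑) : X → E2)) :=
    IsFiniteMeasureOnCompacts.comap' _ continuous_subtype_val (MeasurableEmbedding.subtype_coe hXm)
  obtain ⟨G', hG'm, hG'⟩ := measurable_uncurry_of_dense_aemeasurable (X := X) (μ := μ)
    (G := fun s x => G s x) (hG.mono fun s hs => hs.comp continuous_subtype_val) fun x => x.2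
  set ν := (volume : Measure E2).comap ((↑) : X → E2) with hν
  calc ∫⁻ x, ‖∫ s, G s x ∂μ‖ₑ = ∫⁻ x in X, ‖∫ s, G s x ∂μ‖ₑ := by
        rw [← lintegral_indicator hXm]
        refine lintegral_congr fun x => ?_
        by_cases hx : x ∈ X
        · rw [Set.indicator_of_mem hx]
        · rw [Set.indicator_of_notMem hx, integral_non_aestronglyMeasurable hx, enorm_zero]
    _ = ∫⁻ x : X, ‖∫ s, G s x ∂μ‖ₑ ∂ν :=
        (lintegral_subtype_comap hXm fun x => ‖∫ s, G s x ∂μ‖ₑ).symm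
    _ ≤ ∫⁻ x : X, ∫⁻ s, ‖G' s x‖ₑ ∂μ ∂ν := by
        refine lintegral_mono fun x => (enorm_integral_le_lintegral_enorm _).trans_eq ?_
        exact lintegral_congr_ae (hG'.mono fun s hs => by simp only [hs])
    _ = ∫⁻ s, ∫⁻ x : X, ‖G' s x‖ₑ ∂ν ∂μ :=
        lintegral_lintegral_swap (f := fun (x : X) s => ‖G' s x‖ₑ)
          (hG'm.enorm.comp measurable_swap).aemeasurable
    _ ≤ ∫⁻ s, b s ∂μ := by
        refine lintegral_mono_ae ?_
        filter_upwards [hG', hb] with s h1 h2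
        simp only [h1]
        exact ((lintegral_subtype_comap hXm fun x => ‖G s x‖ₑ).trans_le
          (setLIntegral_le_lintegral _ _)).trans h2

lemma continuous_heat_convolution {τ A : ℝ} (hτ : 0 < τ) {u : E2 → E2}
    (hu : StronglyMeasurable u) (hA : ∀ y j, ‖u y j‖ ≤ A) {w : E2 → ℝ} (hw : Integrable w) :
    Continuous fun x => ∫ y, ∑ j : Fin 2, dheatK j (x - y) τ * (u y j * w y) := by
  have hA0 : 0 ≤ A := (norm_nonneg _).trans (hA 0 0)
  set B := 2 * τ ^ (-(1 / 2) : ℝ) * (4 * π * (2 * τ))⁻¹ with hB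
  have hB0 : 0 ≤ B := by positivity
  have hd j x : ‖dheatK j x τ‖ ≤ B := by
    refine (abs_dheatK_le j x hτ).trans ?_
    rw [hB]
    gcongr
    exact heatK_le x (by positivity)
  have hum j : AEStronglyMeasurable fun y => u y j :=
    ((EuclideanSpace.proj (𝕜 := ℝ) j).continuous.comp_stronglyMeasurable hu).aestronglyMeasurable
  refine continuous_of_dominated (bound := fun y => ∑ _j : Fin 2, B * (A * ‖w y‖)) (fun x => ?_)
    (fun x => .of_forall fun y => ?_) ?_ (.of_forall fun y => ?_)
  · refine Finset.aestronglyMeasurable_fun_sum _ fun j _ => ?_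
    exact ((continuous_dheatK j τ).comp (continuous_const.sub continuous_id)).aestronglyMeasurable.mul
      ((hum j).mul hw.aestronglyMeasurable)
  · refine (norm_sum_le _ _).trans (Finset.sum_le_sum fun j _ => ?_)
    rw [norm_mul, norm_mul]
    gcongr
    · exact hd j _
    · exact hA y j
  · exact integrable_finsetSum _ fun j _ => (hw.norm.const_mul A).const_mul B
  · exact continuous_finsetSum _ fun j _ =>
      ((continuous_dheatK j τ).comp (continuous_id.sub continuous_const)).mul continuous_const

lemma lintegral_heat_convolution_le {τ : ℝ} (hτ : 0 < τ) {u : E2 → E2} {A : ℝ≥0∞}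
    (hA : ∀ y j, ‖u y j‖ₑ ≤ A) {w : E2 → ℝ} (hw : Integrable w) :
    ∫⁻ x, ‖∫ y, ∑ j : Fin 2, dheatK j (x - y) τ * (u y j * w y)‖ₑ ≤
      2 * ENNReal.ofReal (2 * τ ^ (-(1 / 2) : ℝ)) * A * eLpNorm w 1 volume := by
  have hwm := hw.aestronglyMeasurable.enorm
  have hdm j : Measurable fun x => ‖dheatK j x τ‖ₑ := (continuous_dheatK j τ).measurable.enorm
  have hdm' j y : Measurable fun x => ‖dheatK j (x - y) τ‖ₑ :=
    (hdm j).comp (measurable_id.sub_const y)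
  have hAw : AEMeasurable fun y => A * ‖w y‖ₑ := hwm.const_mul A
  have hprod j : AEMeasurable (Function.uncurry fun x y : E2 =>
      ‖dheatK j (x - y) τ‖ₑ * (A * ‖w y‖ₑ)) (volume.prod volume) :=
    ((hdm j).comp (measurable_fst.sub measurable_snd)).aemeasurable.mul hAw.comp_snd
  calc ∫⁻ x, ‖∫ y, ∑ j : Fin 2, dheatK j (x - y) τ * (u y j * w y)‖ₑ
      ≤ ∫⁻ x, ∫⁻ y, ∑ j : Fin 2, ‖dheatK j (x - y) τ‖ₑ * (A * ‖w y‖ₑ) := by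
        refine lintegral_mono fun x => (enorm_integral_le_lintegral_enorm _).trans
          (lintegral_mono fun y => (enorm_sum_le _ _).trans (Finset.sum_le_sum fun j _ => ?_))
        rw [enorm_mul, enorm_mul]
        gcongr
        exact hA y j
    _ = ∫⁻ y, ∫⁻ x, ∑ j : Fin 2, ‖dheatK j (x - y) τ‖ₑ * (A * ‖w y‖ₑ) := by
        refine lintegral_lintegral_swap ?_
        exact Finset.aemeasurable_fun_sum _ fun j _ => hprod j
    _ ≤ ∫⁻ y, 2 * ENNReal.ofReal (2 * τ ^ (-(1 / 2) : ℝ)) * (A * ‖w y‖ₑ) := by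
        refine lintegral_mono fun y => ?_
        rw [lintegral_finsetSum _ fun j _ => (hdm' j y).mul_const _]
        have hj j : ∫⁻ x, ‖dheatK j (x - y) τ‖ₑ * (A * ‖w y‖ₑ) ≤
            ENNReal.ofReal (2 * τ ^ (-(1 / 2) : ℝ)) * (A * ‖w y‖ₑ) := by
          rw [lintegral_mul_const _ (hdm' j y),
            lintegral_sub_right_eq_self (fun x => ‖dheatK j x τ‖ₑ) y]
          gcongr
          exact lintegral_enorm_dheatK_le j hτ
        refine (Finset.sum_le_sum fun j _ => hj j).trans_eq ?_
        simp [mul_assoc]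
    _ = _ := by
        rw [lintegral_const_mul'' _ hAw, lintegral_const_mul'' _ hwm,
          eLpNorm_one_eq_lintegral_enorm]
        ring

lemma lintegral_rpow_neg_half {t : ℝ} (ht : 0 ≤ t) :
    ∫⁻ s in Set.Icc 0 t, ENNReal.ofReal (2 * (t - s) ^ (-(1 / 2) : ℝ)) =
      ENNReal.ofReal (4 * t ^ (1 / 2 : ℝ)) := by
  have hi : IntervalIntegrable (fun s : ℝ => 2 * (t - s) ^ (-(1 / 2) : ℝ)) volume 0 t := by
    have := (intervalIntegral.intervalIntegrable_rpow' (a := t) (b := 0)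
      (r := -(1 / 2)) (by norm_num)).comp_sub_left t
    simpa using this.const_mul 2
  rw [setLIntegral_congr Ioc_ae_eq_Icc.symm, ← ofReal_integral_eq_lintegral_ofReal
    ((intervalIntegrable_iff_integrableOn_Ioc_of_le ht).1 hi) ?_,
    ← intervalIntegral.integral_of_le ht, intervalIntegral.integral_const_mul,
    intervalIntegral.integral_comp_sub_left fun s => s ^ (-(1 / 2) : ℝ),
    integral_rpow (.inl (by norm_num))]
  · congr 1
    rw [sub_self, sub_zero, Real.zero_rpow (by norm_num)]
    norm_num
    ring
  · filter_upwards [ae_restrict_mem measurableSet_Ioc] with s hs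
    have := Real.rpow_nonneg (sub_nonneg.2 hs.2) (-(1 / 2))
    simpa using this

/-- Lemma 4.1: the bilinear (Duhamel) term
`𝓑(ṽ,w̃)(t) = ∫₀ᵗ Σ_j ∂_jΦ(·,t-s) * (u_j(s) w̃(s)) ds`, where `u(s) = K * h(s)` and
`h(s) - α²Δh(s) = ṽ(s)`, satisfies
`sup_t ‖𝓑(ṽ,w̃)(t)‖_{L¹} ≤ C T^{1/2} (sup_s ‖ṽ(s)‖_{L¹}) (sup_s ‖w̃(s)‖_{L¹})`. -/
theorem bilinear_L1_bound (α : ℝ) (hα : 0 < α) :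
    ∃ C : ℝ, 0 < C ∧ ∀ T : ℝ, 0 < T → ∀ v w h : ℝ → E2 → ℝ,
      (∀ s ∈ Set.Icc (0 : ℝ) T, MemLp (v s) 1 volume) →
      (∀ s ∈ Set.Icc (0 : ℝ) T, MemLp (w s) 1 volume) →
      (∀ s ∈ Set.Icc (0 : ℝ) T, MemLp (h s) 1 volume) →
      (⨆ s ∈ Set.Icc (0 : ℝ) T, eLpNorm (v s) 1 volume) < ⊤ →
      (⨆ s ∈ Set.Icc (0 : ℝ) T, eLpNorm (w s) 1 volume) < ⊤ →
      (∀ᵐ s ∂(volume.restrict (Set.Icc (0 : ℝ) T)),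
        ∀ φ : E2 → ℝ, ContDiff ℝ (⊤ : ℕ∞) φ → HasCompactSupport φ →
          ∫ x, h s x * (φ x - α ^ 2 * lap φ x) = ∫ x, v s x * φ x) →
      ∀ t ∈ Set.Icc (0 : ℝ) T,
        eLpNorm (fun x => ∫ s in Set.Icc (0 : ℝ) t, ∫ y,
            ∑ j : Fin 2, dheatK j (x - y) (t - s) * (biotSavart (h s) y j * w s y)) 1 volume
          ≤ ENNReal.ofReal (C * T ^ (1 / 2 : ℝ))
              * (⨆ s ∈ Set.Icc (0 : ℝ) T, eLpNorm (v s) 1 volume)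
              * (⨆ s ∈ Set.Icc (0 : ℝ) T, eLpNorm (w s) 1 volume) := by
  obtain ⟨M, hM, hMle⟩ := exists_lintegral_invNorm_besselMeas_le hα
  refine ⟨8 * M.toReal + 1, by positivity, ?_⟩
  intro T hT v w h hv hw hh hVtop _ heq t ht
  set V := ⨆ s ∈ Set.Icc (0 : ℝ) T, eLpNorm (v s) 1 volume with hV
  set W := ⨆ s ∈ Set.Icc (0 : ℝ) T, eLpNorm (w s) 1 volume with hW
  have hsub : Set.Icc (0 : ℝ) t ⊆ Set.Icc 0 T := Set.Icc_subset_Icc_right ht.2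
  have hae : ∀ᵐ s ∂(volume.restrict (Set.Icc (0 : ℝ) t)), s ∈ Set.Icc (0 : ℝ) T ∧ s < t ∧
      ∀ y j, ‖biotSavart (h s) y j‖ₑ ≤ M * V := by
    filter_upwards [ae_mono (Measure.restrict_mono hsub le_rfl) heq,
      ae_restrict_mem measurableSet_Icc, Measure.ae_ne (volume.restrict (Set.Icc (0 : ℝ) t)) t]
      with s hs hst hne
    have hsT := hsub hst
    refine ⟨hsT, lt_of_le_of_ne hst.2 hne, fun y j => (enorm_biotSavart_le _ _ _).trans ?_⟩
    refine (lintegral_invNorm_mul_le hα hMle (memLp_one_iff_integrable.1 (hh s hsT))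
      (memLp_one_iff_integrable.1 (hv s hsT)) hs y).trans ?_
    gcongr
    exact le_iSup₂ (f := fun s (_ : s ∈ Set.Icc (0 : ℝ) T) => eLpNorm (v s) 1 volume) s hsT
  rw [eLpNorm_one_eq_lintegral_enorm]
  calc _ ≤ ∫⁻ s in Set.Icc (0 : ℝ) t,
          ENNReal.ofReal (2 * (t - s) ^ (-(1 / 2) : ℝ)) * (2 * (M * V) * W) := by
        refine lintegral_enorm_integral_le ?_ ?_
        · filter_upwards [hae] with s ⟨hsT, hst, hu⟩
          refine continuous_heat_convolution (A := (M * V).toReal) (sub_pos.2 hst)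
            (stronglyMeasurable_biotSavart (hh s hsT).1) (fun y j => ?_)
            (memLp_one_iff_integrable.1 (hw s hsT))
          rw [← toReal_enorm]
          exact ENNReal.toReal_mono (ENNReal.mul_ne_top hM hVtop.ne) (hu y j)
        · filter_upwards [hae] with s ⟨hsT, hst, hu⟩
          refine (lintegral_heat_convolution_le (sub_pos.2 hst) hu
            (memLp_one_iff_integrable.1 (hw s hsT))).trans ?_
          have : eLpNorm (w s) 1 volume ≤ W :=
            le_iSup₂ (f := fun s (_ : s ∈ Set.Icc (0 : ℝ) T) => eLpNorm (w s) 1 volume) s hsT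
          refine (mul_le_mul_right this _).trans_eq ?_
          ring
    _ = ENNReal.ofReal (4 * t ^ (1 / 2 : ℝ)) * (2 * (M * V) * W) := by
        rw [lintegral_mul_const _ (by fun_prop), lintegral_rpow_neg_half ht.1]
    _ = ENNReal.ofReal (8 * M.toReal * t ^ (1 / 2 : ℝ)) * V * W := by
        rw [show 8 * M.toReal * t ^ (1 / 2 : ℝ) = 4 * t ^ (1 / 2 : ℝ) * (2 * M.toReal) by ring,
          ENNReal.ofReal_mul (p := 4 * t ^ (1 / 2 : ℝ))
            (mul_nonneg (by norm_num) (Real.rpow_nonneg ht.1 _)),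
          ENNReal.ofReal_mul (p := 2) (by norm_num), ENNReal.ofReal_toReal hM,
          ENNReal.ofReal_ofNat]
        ring
    _ ≤ _ := by
        have h0 := ht.1
        have h1 := ht.2
        gcongr
        linarith
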